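/- arXiv:math/9811100 — 2 statements merged into one kernel-verified Lean document; each statement's English description precedes it below -/
import Mathlib

section
/- Let n ≥ 1 and let x be an invertible totally nonnegative n×n real matrix. Then x is totally positive if and only if for every k ∈ {1, …, n} the solid antidiagonal corner minors of x are positive, i.e., the determinant of the submatrix of x with rows 1, …, k and columns n−k+1, …, n is positive and the determinant of the submatrix with rows n−k+1, …, n and columns 1, …, k is positive. -/
/-- A square real matrix is totally nonnegative if every minor (determinant of a
square submatrix selected by strictly increasing row and column indices) is nonnegative. -/
def TotallyNonneg {n : ℕ} (x : Matrix (Fin n) (Fin n) ℝ) : Prop :=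
  ∀ (k : ℕ) (f g : Fin k → Fin n), StrictMono f → StrictMono g →
    0 ≤ (x.submatrix f g).det

/-- A square real matrix is totally positive if every minor is positive. -/
def TotallyPos {n : ℕ} (x : Matrix (Fin n) (Fin n) ℝ) : Prop :=
  ∀ (k : ℕ) (f g : Fin k → Fin n), StrictMono f → StrictMono g →
    0 < (x.submatrix f g).det

section LinearAlgebra

open Matrix

variable {ι R : Type*} [Fintype ι] [DecidableEq ι] [CommRing R]

theorem adjugate_apply_eq_det_updateCol (N : Matrix ι ι R) (s p : ι) :
    N.adjugate s p = (N.updateCol s (Pi.single p 1)).det := by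
  rw [← cramer_apply, cramer_eq_adjugate_mulVec, mulVec_single_one, col_apply]

/-- A null vector of a square matrix is proportional to every column of its adjugate. -/
theorem mul_adjugate_comm_of_mulVec_eq_zero [IsDomain R] {N : Matrix ι ι R} {v : ι → R}
    (h : N *ᵥ v = 0) (r s t : ι) :
    v t * N.adjugate s r = v s * N.adjugate t r := by
  by_cases hv : v = 0
  · simp [hv]
  have key : (N.updateRow r (v t • Pi.single s 1 + (-v s) • Pi.single t 1)).det = 0 := by
    rw [← exists_mulVec_eq_zero_iff]
    refine ⟨v, hv, funext fun i => ?_⟩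
    by_cases hi : i = r
    · subst hi
      rw [mulVec, updateRow_self, add_dotProduct, smul_dotProduct, smul_dotProduct]
      simp [mul_comm]
    · have := congrFun h i
      simpa [mulVec, updateRow_ne hi] using this
  rw [det_updateRow_add, det_updateRow_smul, det_updateRow_smul, ← adjugate_apply,
    ← adjugate_apply] at key
  linear_combination key

/-- Jacobi's identity for the `2 × 2` minors of the adjugate. -/
theorem det_mul_adjugate_updateCol (N : Matrix ι ι R) {s t : ι} (hst : s ≠ t) (p q : ι) :
    N.det * (N.updateCol s (Pi.single p 1)).adjugate t q =
      N.adjugate s p * N.adjugate t q - N.adjugate t p * N.adjugate s q := by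
  set M := N.updateCol s (Pi.single p 1) with hM
  set b : ι → R := fun j => N.adjugate j q with hb
  have hNb : N *ᵥ b = N.det • Pi.single q 1 := by
    have : b = N.adjugate *ᵥ Pi.single q 1 := by
      rw [mulVec_single_one]; rfl
    rw [this, mulVec_mulVec, mul_adjugate, smul_mulVec, one_mulVec]
  have hself : ∀ w, M.cramer (M *ᵥ w) = M.det • w := fun w => by
    rw [cramer_eq_adjugate_mulVec, mulVec_mulVec, adjugate_mul, smul_mulVec, one_mulVec]
  have hp : Pi.single p 1 = M *ᵥ Pi.single s 1 := by
    rw [mulVec_single_one]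
    ext i
    simp [hM]
  have hsplit : N *ᵥ b = M *ᵥ b + b s • (N.col s - Pi.single p 1) := by
    have : N = M + vecMulVec (N.col s - Pi.single p 1) (Pi.single s 1) := by
      ext i j
      by_cases hj : j = s
      · subst hj; simp [hM, vecMulVec_apply]
      · simp [hM, vecMulVec_apply, hj]
    conv_lhs => rw [this]
    rw [add_mulVec, vecMulVec_mulVec]
    simp
  have hswap : M.cramer (N.col s) t = -N.adjugate t p := by
    rw [cramer_apply, adjugate_apply_eq_det_updateCol]
    have : M.updateCol t (N.col s) =
        (N.updateCol t (Pi.single p 1)).submatrix id (Equiv.swap s t) := by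
      ext i j
      by_cases hjt : j = t
      · subst hjt; simp [hst]
      · by_cases hjs : j = s
        · subst hjs; simp [hM, hst]
        · simp [hM, hjs, hjt, Equiv.swap_apply_of_ne_of_ne hjs hjt]
    rw [this, det_permute', Equiv.Perm.sign_swap hst]
    simp
  have h1 : M.cramer (N *ᵥ b) t = N.det * M.adjugate t q := by
    rw [hNb, map_smul, cramer_eq_adjugate_mulVec, mulVec_single_one]
    simp
  have h2 : M.cramer (N *ᵥ b) t = M.det * b t + b s * (-N.adjugate t p) := by
    rw [hsplit, map_add, map_smul, map_sub, hself, hp, hself, ← hswap]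
    simp [hst.symm]
  rw [← h1, h2, adjugate_apply_eq_det_updateCol N s p]
  ring

/-- The Desnanot–Jacobi identity, for two arbitrary rows and two arbitrary columns. -/
theorem det_mul_det_submatrix_succAbove {m : ℕ} (N : Matrix (Fin (m + 2)) (Fin (m + 2)) R)
    {p s : Fin (m + 1)} {q t : Fin (m + 2)} (hpq : p.castSucc < q) (hst : s.castSucc < t) :
    N.det * ((N.submatrix q.succAbove t.succAbove).submatrix p.succAbove s.succAbove).det =
      (N.submatrix p.castSucc.succAbove s.castSucc.succAbove).det *
        (N.submatrix q.succAbove t.succAbove).det -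
      (N.submatrix p.castSucc.succAbove t.succAbove).det *
        (N.submatrix q.succAbove s.castSucc.succAbove).det := by
  have h := det_mul_adjugate_updateCol N hst.ne p.castSucc q
  have hsub : (N.updateCol s.castSucc (Pi.single p.castSucc 1)).submatrix
      q.succAbove t.succAbove =
      (N.submatrix q.succAbove t.succAbove).updateCol s (Pi.single p 1) := by
    ext i j
    by_cases hj : j = s
    · subst hj
      have hp : q.succAbove p = p.castSucc := Fin.succAbove_of_castSucc_lt _ _ hpq
      have hs : t.succAbove j = j.castSucc := Fin.succAbove_of_castSucc_lt _ _ hst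
      simp only [submatrix_apply, hs, updateCol_self, ← hp]
      simp [Pi.single_apply]
    · have hs : t.succAbove s = s.castSucc := Fin.succAbove_of_castSucc_lt _ _ hst
      have : t.succAbove j ≠ s.castSucc := by
        rw [← hs]; simpa using hj
      simp [this, hj]
  rw [adjugate_fin_succ_eq_det_submatrix (N.updateCol _ _), hsub,
    ← adjugate_apply_eq_det_updateCol] at h
  simp only [adjugate_fin_succ_eq_det_submatrix, Fin.val_castSucc] at h
  have e : ((-1 : R) ^ (q.val + t.val + (p.val + s.val))) ^ 2 = 1 := by
    rw [← pow_mul, mul_comm, pow_mul]; simp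
  simp only [pow_add] at h e
  linear_combination ((-1) ^ q.val * (-1) ^ t.val * ((-1) ^ p.val * (-1) ^ s.val)) * h -
    (N.det * ((N.submatrix q.succAbove t.succAbove).submatrix p.succAbove s.succAbove).det -
      ((N.submatrix p.castSucc.succAbove s.castSucc.succAbove).det *
        (N.submatrix q.succAbove t.succAbove).det -
      (N.submatrix p.castSucc.succAbove t.succAbove).det *
        (N.submatrix q.succAbove s.castSucc.succAbove).det)) * e

/-- The signed maximal minors of a matrix with one more column than rows form a null vector. -/
theorem mulVec_signed_minors_eq_zero {k : ℕ} (N : Matrix (Fin k) (Fin (k + 1)) R) :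
    N *ᵥ (fun t => (-1) ^ (t : ℕ) * (N.submatrix id t.succAbove).det) = 0 := by
  funext i
  have h : (N.submatrix (Fin.cons i id : Fin (k + 1) → Fin k) id).det = 0 :=
    det_zero_of_row_eq (Fin.succ_ne_zero i).symm (by ext j; simp)
  rw [det_succ_row_zero] at h
  rw [Pi.zero_apply, ← h, mulVec, dotProduct]
  refine Finset.sum_congr rfl fun j _ => ?_
  have : (N.submatrix (Fin.cons i id : Fin (k + 1) → Fin k) id).submatrix
      Fin.succ j.succAbove = N.submatrix id j.succAbove := by
    ext a b; simp
  rw [this, submatrix_apply, Fin.cons_zero, id]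
  ring

end LinearAlgebra

section SortedMinors

open Finset Matrix

variable {n : ℕ}

/-- The `k × k` minor of `x` with row set `S` and column set `T`, both listed increasingly
(zero by convention if one of the sets does not have `k` elements). -/
noncomputable def sortedMinor (x : Matrix (Fin n) (Fin n) ℝ) (k : ℕ) (S T : Finset (Fin n)) : ℝ :=
  if h : S.card = k ∧ T.card = k then
    (x.submatrix (S.orderEmbOfFin h.1) (T.orderEmbOfFin h.2)).det
  else 0

theorem card_image_univ_of_injective {k : ℕ} {f : Fin k → Fin n} (hf : Function.Injective f) :
    (univ.image f).card = k := by
  rw [card_image_of_injective _ hf, card_univ, Fintype.card_fin]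

theorem sortedMinor_image {k : ℕ} (x : Matrix (Fin n) (Fin n) ℝ) {f g : Fin k → Fin n}
    (hf : StrictMono f) (hg : StrictMono g) :
    sortedMinor x k (univ.image f) (univ.image g) = (x.submatrix f g).det := by
  have h1 := card_image_univ_of_injective hf.injective
  have h2 := card_image_univ_of_injective hg.injective
  rw [sortedMinor, dif_pos ⟨h1, h2⟩,
    ← orderEmbOfFin_unique h1 (fun a => mem_image_of_mem f (mem_univ a)) hf,
    ← orderEmbOfFin_unique h2 (fun a => mem_image_of_mem g (mem_univ a)) hg]

theorem sortedMinor_transpose (x : Matrix (Fin n) (Fin n) ℝ) (k : ℕ) (S T : Finset (Fin n)) :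
    sortedMinor xᵀ k T S = sortedMinor x k S T := by
  unfold sortedMinor
  by_cases h : S.card = k ∧ T.card = k
  · rw [dif_pos h, dif_pos h.symm, ← det_transpose]
    rfl
  · rw [dif_neg h, dif_neg (fun h' => h h'.symm)]

theorem abs_det_submatrix_eq_abs_sortedMinor {ι : Type*} [Fintype ι] [DecidableEq ι] {k : ℕ}
    (x : Matrix (Fin n) (Fin n) ℝ) {f g : ι → Fin n} (hf : Function.Injective f)
    (hg : Function.Injective g) (hk : Fintype.card ι = k) :
    |(x.submatrix f g).det| = |sortedMinor x k (univ.image f) (univ.image g)| := by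
  have key : ∀ {f : ι → Fin n}, Function.Injective f → ∀ hc : (univ.image f).card = k,
      ∃ e : ι ≃ Fin k, f = (univ.image f).orderEmbOfFin hc ∘ e := by
    intro f hf hc
    let e₁ : ι ≃ (univ.image f : Finset (Fin n)) :=
      Equiv.ofBijective (fun a => ⟨f a, mem_image_of_mem f (mem_univ a)⟩)
        ⟨fun a b hab => hf (Subtype.ext_iff.1 hab), fun ⟨b, hb⟩ => by
          obtain ⟨a, -, rfl⟩ := mem_image.1 hb
          exact ⟨a, rfl⟩⟩
    refine ⟨e₁.trans ((univ.image f).orderIsoOfFin hc).toEquiv.symm, funext fun a => ?_⟩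
    rw [Function.comp_apply, ← coe_orderIsoOfFin_apply]
    rw [show f a = ((e₁ a : (univ.image f : Finset (Fin n))) : Fin n) from rfl]
    simp
  have hcf : (univ.image f).card = k := by rw [card_image_of_injective _ hf, card_univ, hk]
  have hcg : (univ.image g).card = k := by rw [card_image_of_injective _ hg, card_univ, hk]
  obtain ⟨e, he⟩ := key hf hcf
  obtain ⟨e', he'⟩ := key hg hcg
  rw [sortedMinor, dif_pos ⟨hcf, hcg⟩]
  conv_lhs => rw [he, he', ← submatrix_submatrix]
  exact abs_det_submatrix_equiv_equiv _ _ _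

theorem TotallyNonneg.transpose {x : Matrix (Fin n) (Fin n) ℝ} (hx : TotallyNonneg x) :
    TotallyNonneg xᵀ := fun k f g hf hg => by
  rw [← det_transpose]
  exact hx k g f hg hf

theorem TotallyNonneg.sortedMinor_nonneg {x : Matrix (Fin n) (Fin n) ℝ} (hx : TotallyNonneg x)
    (k : ℕ) (S T : Finset (Fin n)) : 0 ≤ sortedMinor x k S T := by
  unfold sortedMinor
  split_ifs with h
  · exact hx k _ _ (OrderEmbedding.strictMono _) (OrderEmbedding.strictMono _)
  · exact le_rfl

theorem image_comp_succAbove {k : ℕ} {f : Fin (k + 1) → Fin n} (hf : Function.Injective f)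
    (p : Fin (k + 1)) :
    univ.image (f ∘ p.succAbove) = (univ.image f).erase (f p) := by
  ext a
  simp only [mem_image, mem_univ, true_and, mem_erase, Function.comp_apply]
  constructor
  · rintro ⟨u, rfl⟩
    exact ⟨fun h => Fin.succAbove_ne p u (hf h), _, rfl⟩
  · rintro ⟨h, u, rfl⟩
    obtain ⟨v, hv⟩ := Fin.exists_succAbove_eq (x := u) (y := p) (fun e => h (by rw [e]))
    exact ⟨v, by rw [hv]⟩

theorem det_submatrix_comp_succAbove {k : ℕ} (x : Matrix (Fin n) (Fin n) ℝ)
    {f : Fin (k + 1) → Fin n} {g : Fin (k + 1) → Fin n} (hf : StrictMono f) (hg : StrictMono g)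
    (p q : Fin (k + 1)) :
    (x.submatrix (f ∘ p.succAbove) (g ∘ q.succAbove)).det =
      sortedMinor x k ((univ.image f).erase (f p)) ((univ.image g).erase (g q)) := by
  rw [← image_comp_succAbove hf.injective, ← image_comp_succAbove hg.injective,
    sortedMinor_image x (hf.comp (Fin.strictMono_succAbove p))
      (hg.comp (Fin.strictMono_succAbove q))]

theorem exists_strictMono_image_eq {k : ℕ} {S : Finset (Fin n)} (hS : S.card = k) :
    ∃ f : Fin k → Fin n, StrictMono f ∧ univ.image f = S :=
  ⟨S.orderEmbOfFin hS, OrderEmbedding.strictMono _, image_orderEmbOfFin_univ S hS⟩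

/-- The bordered minors of a totally nonnegative matrix around a fixed block have nonnegative
`2 × 2` minors. -/
theorem TotallyNonneg.sortedMinor_insert_mul_le {x : Matrix (Fin n) (Fin n) ℝ}
    (hx : TotallyNonneg x) {m : ℕ} {A B : Finset (Fin n)} (hA : A.card = m) (hB : B.card = m)
    {r r' s s' : Fin n} (hr : r ∉ A) (hr' : r' ∉ A) (hs : s ∉ B) (hs' : s' ∉ B)
    (hrr : r < r') (hss : s < s') :
    sortedMinor x (m + 1) (insert r A) (insert s' B) *
        sortedMinor x (m + 1) (insert r' A) (insert s B) ≤
      sortedMinor x (m + 1) (insert r A) (insert s B) *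
        sortedMinor x (m + 1) (insert r' A) (insert s' B) := by
  have key : ∀ {A : Finset (Fin n)} {r r' : Fin n}, A.card = m → r ∉ A → r' ∉ A → r < r' →
      ∃ (f : Fin (m + 2) → Fin n) (p : Fin (m + 1)) (q : Fin (m + 2)), StrictMono f ∧
        p.castSucc < q ∧ (univ.image f).erase (f p.castSucc) = insert r' A ∧
        (univ.image f).erase (f q) = insert r A := by
    intro A r r' hA hr hr' hrr
    have hcard : (insert r (insert r' A)).card = m + 2 := by
      rw [card_insert_of_notMem (by simp [hr, hrr.ne]), card_insert_of_notMem hr', hA]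
    obtain ⟨f, hf, hfS⟩ := exists_strictMono_image_eq hcard
    obtain ⟨p, -, hp⟩ := mem_image.1 (show r ∈ univ.image f by simp [hfS])
    obtain ⟨q, -, hq⟩ := mem_image.1 (show r' ∈ univ.image f by simp [hfS])
    have hpq : p < q := hf.lt_iff_lt.1 (by rwa [hp, hq])
    refine ⟨f, p.castPred (Fin.ne_last_of_lt hpq), q, hf, by simpa using hpq, ?_, ?_⟩
    · rw [Fin.castSucc_castPred, hp, hfS, erase_insert (by simp [hr, hrr.ne])]
    · rw [hq, hfS, insert_comm, erase_insert (by simp [hr', hrr.ne'])]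
  obtain ⟨f, p, q, hf, hpq, hfp, hfq⟩ := key hA hr hr' hrr
  obtain ⟨g, u, v, hg, huv, hgu, hgv⟩ := key hB hs hs' hss
  have h := det_mul_det_submatrix_succAbove (x.submatrix f g) hpq huv
  simp only [submatrix_submatrix, det_submatrix_comp_succAbove x hf hg, hfp, hfq, hgu, hgv] at h
  have h1 := hx _ f g hf hg
  have h2 := hx _ _ _ ((hf.comp (Fin.strictMono_succAbove q)).comp (Fin.strictMono_succAbove p))
    ((hg.comp (Fin.strictMono_succAbove v)).comp (Fin.strictMono_succAbove u))
  have h3 := mul_nonneg h1 h2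
  rw [h] at h3
  linarith

/-- If a minor vanishes while the minors with one row and one column fewer are positive, then
exchanging its first column for a column `l` gives a nonzero minor only when `l` is not
strictly inside the range of the columns; when `l` is to the right, exchanging the last column
works too. -/
theorem TotallyNonneg.exchange_column {x : Matrix (Fin n) (Fin n) ℝ}
    (hx : TotallyNonneg x) {m : ℕ} {I J : Finset (Fin n)} (hI : I.card = m + 1)
    (hJ : J.card = m + 1) {r a c l : Fin n} (hr : r ∈ I) (ha : a ∈ J) (hamin : ∀ b ∈ J, a ≤ b)
    (hc : c ∈ J) (hcmax : ∀ b ∈ J, b ≤ c) (hl : l ∉ J)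
    (hpos : ∀ s ∈ J, 0 < sortedMinor x m (I.erase r) (J.erase s))
    (hIJ : sortedMinor x (m + 1) I J = 0)
    (hne : sortedMinor x (m + 1) I (insert l (J.erase a)) ≠ 0) (hal : a < l) :
    c < l ∧ sortedMinor x (m + 1) I (insert l (J.erase c)) ≠ 0 := by
  obtain ⟨f, hf, rfl⟩ := exists_strictMono_image_eq hI
  obtain ⟨r, -, rfl⟩ := mem_image.1 hr
  have hT : (insert l J).card = m + 2 := by rw [card_insert_of_notMem hl, hJ]
  obtain ⟨g, hg, hgT⟩ := exists_strictMono_image_eq hT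
  obtain ⟨p, -, hp⟩ := mem_image.1 (show l ∈ univ.image g by simp [hgT])
  have hgJ : univ.image (g ∘ p.succAbove) = J := by
    rw [image_comp_succAbove hg.injective, hgT, hp, erase_insert hl]
  have hgp := hg.comp (Fin.strictMono_succAbove p)
  have hga : g (p.succAbove 0) = a := by
    rw [← hgJ] at ha hamin
    obtain ⟨u, -, hu⟩ := mem_image.1 ha
    refine le_antisymm ?_ (hamin _ (mem_image_of_mem (g ∘ p.succAbove) (mem_univ 0)))
    rw [← hu]
    exact hgp.monotone (Fin.zero_le u)
  have hgc : g (p.succAbove (Fin.last m)) = c := by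
    rw [← hgJ] at hc hcmax
    obtain ⟨u, -, hu⟩ := mem_image.1 hc
    refine le_antisymm (hcmax _ (mem_image_of_mem (g ∘ p.succAbove) (mem_univ _))) ?_
    rw [← hu]
    exact hgp.monotone (Fin.le_last u)
  set N := x.submatrix f g with hN
  set w : Fin (m + 2) → ℝ := fun t => (-1) ^ (t : ℕ) * (N.submatrix id t.succAbove).det with hw
  have hW : ∀ u, w (p.succAbove u) = (-1) ^ ((p.succAbove u : Fin (m + 2)) : ℕ) *
      sortedMinor x (m + 1) (univ.image f) (insert l (J.erase (g (p.succAbove u)))) := by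
    intro u
    have h1 : insert l (J.erase (g (p.succAbove u))) =
        univ.image (g ∘ (p.succAbove u).succAbove) := by
      rw [image_comp_succAbove hg.injective, hgT, erase_insert_of_ne]
      rw [← hp]
      exact fun e => Fin.succAbove_ne p u (hg.injective e).symm
    rw [h1, sortedMinor_image x hf (hg.comp (Fin.strictMono_succAbove _))]
    rfl
  have hwp : w p = 0 := by
    have : (N.submatrix id p.succAbove).det = 0 := by
      rw [← hIJ, ← hgJ, sortedMinor_image x hf hgp]
      rfl
    simp [hw, this]
  have hker : (x.submatrix f (g ∘ p.succAbove)) *ᵥ (w ∘ p.succAbove) = 0 := by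
    have h := mulVec_signed_minors_eq_zero N
    funext i
    have hi := congrFun h i
    rw [mulVec, dotProduct, Fin.sum_univ_succAbove _ p] at hi
    have hwp' := hwp
    simp only [hw] at hwp'
    rw [hwp', mul_zero, zero_add] at hi
    exact hi
  have hadj : ∀ u, (x.submatrix f (g ∘ p.succAbove)).adjugate u r = (-1) ^ (r.val + u.val) *
      sortedMinor x m ((univ.image f).erase (f r)) (J.erase (g (p.succAbove u))) := by
    intro u
    rw [adjugate_fin_succ_eq_det_submatrix, submatrix_submatrix,
      det_submatrix_comp_succAbove x hf hgp, hgJ]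
    rfl
  have hcomm := mul_adjugate_comm_of_mulVec_eq_zero hker r 0 (Fin.last m)
  simp only [Function.comp_apply, hW, hadj, hga, hgc] at hcomm
  have hp0 : p ≠ 0 := by
    rintro rfl
    have : g 0 ≤ a := by rw [← hga]; exact hg.monotone (Fin.zero_le _)
    rw [hp] at this
    exact absurd hal this.not_gt
  have h0 : ((p.succAbove 0 : Fin (m + 2)) : ℕ) = 0 := by
    rw [Fin.succAbove_ne_zero_zero hp0]; rfl
  have hZa := hpos a ha
  have hZc := hpos c hc
  have hWa := hx.sortedMinor_nonneg (m + 1) (univ.image f) (insert l (J.erase a))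
  have hWc := hx.sortedMinor_nonneg (m + 1) (univ.image f) (insert l (J.erase c))
  have hsign : ∀ k : ℕ, ((-1 : ℝ) ^ k) * (-1) ^ k = 1 := fun k => by
    rw [← mul_pow]; simp
  set Wa := sortedMinor x (m + 1) (univ.image f) (insert l (J.erase a))
  set Wc := sortedMinor x (m + 1) (univ.image f) (insert l (J.erase c))
  set Za := sortedMinor x m ((univ.image f).erase (f r)) (J.erase a)
  set Zc := sortedMinor x m ((univ.image f).erase (f r)) (J.erase c)
  have hWaZ : 0 < Wa * Zc := mul_pos (lt_of_le_of_ne hWa (Ne.symm hne)) hZc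
  rw [h0] at hcomm
  simp only [Fin.val_zero, Fin.val_last, pow_add, pow_zero, one_mul, mul_one] at hcomm
  by_cases hpl : p = Fin.last (m + 1)
  · have h1 : ((p.succAbove (Fin.last m) : Fin (m + 2)) : ℕ) = m := by
      rw [hpl, Fin.succAbove_last]; rfl
    rw [h1] at hcomm
    refine ⟨?_, fun hz => ?_⟩
    · rw [← hgc, ← hp]
      apply hg
      rw [hpl, Fin.succAbove_last]
      exact Fin.castSucc_lt_last _
    · rw [hz] at hcomm
      have : Wa * Zc = 0 := by
        linear_combination (-(-1) ^ m * (-1) ^ r.val) * hcomm -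
          Wa * Zc * ((-1) ^ m * (-1) ^ m * hsign r.val + hsign m)
      exact absurd this hWaZ.ne'
  · exfalso
    have h1 : ((p.succAbove (Fin.last m) : Fin (m + 2)) : ℕ) = m + 1 := by
      rw [Fin.succAbove_ne_last_last hpl]; rfl
    rw [h1, pow_succ] at hcomm
    have : Wc * Za + Wa * Zc = 0 := by
      linear_combination (-(-1) ^ m * (-1) ^ r.val) * hcomm -
        (Wc * Za + Wa * Zc) * ((-1) ^ m * (-1) ^ m * hsign r.val + hsign m)
    nlinarith [mul_nonneg hWc hZa.le]

/-- Around a nonsingular block `A × B`, the entries whose bordered minors vanish are given by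
linear combinations of the rows in `A`. -/
theorem exists_eq_sum_of_sortedMinor_insert_eq_zero (x : Matrix (Fin n) (Fin n) ℝ) {m : ℕ}
    {A B : Finset (Fin n)} (hA : A.card = m) (hB : B.card = m) (hAB : sortedMinor x m A B ≠ 0) :
    ∃ (f : Fin m → Fin n) (c : Fin n → Fin m → ℝ), (∀ a, f a ∈ A) ∧ ∀ r s,
      (r ∉ A → s ∉ B → sortedMinor x (m + 1) (insert r A) (insert s B) = 0) →
        x r s = ∑ a, c r a * x (f a) s := by
  obtain ⟨f, hf, rfl⟩ := exists_strictMono_image_eq hA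
  obtain ⟨g, hg, rfl⟩ := exists_strictMono_image_eq hB
  rw [sortedMinor_image x hf hg] at hAB
  set M := x.submatrix f g with hM
  let _ : Invertible M := M.invertibleOfIsUnitDet (isUnit_iff_ne_zero.2 hAB)
  refine ⟨f, fun r => (fun b => x r (g b)) ᵥ* ⅟M, fun a => mem_image_of_mem f (mem_univ a),
    fun r s h => ?_⟩
  have hdet : (x.submatrix (Sum.elim f fun _ : Unit => r) (Sum.elim g fun _ : Unit => s)).det
      = 0 := by
    by_cases hr : r ∈ univ.image f
    · obtain ⟨a, -, rfl⟩ := mem_image.1 hr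
      exact det_zero_of_row_eq (i := Sum.inl a) (j := Sum.inr ()) (by simp) (by ext; simp)
    by_cases hs : s ∈ univ.image g
    · obtain ⟨a, -, rfl⟩ := mem_image.1 hs
      exact det_zero_of_column_eq (i := Sum.inl a) (j := Sum.inr ()) (by simp) (by simp)
    have hinj : ∀ {f : Fin m → Fin n} {r : Fin n}, Function.Injective f → r ∉ univ.image f →
        Function.Injective (Sum.elim f fun _ : Unit => r) := fun hf hr =>
      hf.sumElim (Function.injective_of_subsingleton _)
        fun a _ e => hr (e ▸ mem_image_of_mem _ (mem_univ a))
    have himg : ∀ (f : Fin m → Fin n) (r : Fin n),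
        univ.image (Sum.elim f fun _ : Unit => r) = insert r (univ.image f) := by
      intro f r
      ext a
      simp [eq_comm, or_comm]
    rw [← abs_eq_zero, abs_det_submatrix_eq_abs_sortedMinor x (k := m + 1)
      (hinj hf.injective hr) (hinj hg.injective hs) (by simp), himg, himg, h hr hs, abs_zero]
  have hblock : x.submatrix (Sum.elim f fun _ : Unit => r) (Sum.elim g fun _ : Unit => s) =
      fromBlocks M (Matrix.of fun a _ => x (f a) s) (Matrix.of fun _ b => x r (g b))
        (Matrix.of fun _ _ => x r s) := by
    ext (a | a) (b | b) <;> rfl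
  rw [hblock, det_fromBlocks₁₁, mul_eq_zero, or_iff_right hAB, det_unique] at hdet
  exact sub_eq_zero.1 hdet

/-- In an invertible matrix, a nonsingular block together with any further row extends to a
nonsingular block with one more row and column. -/
theorem exists_sortedMinor_insert_ne_zero {x : Matrix (Fin n) (Fin n) ℝ} (hx : IsUnit x) {m : ℕ}
    {A B : Finset (Fin n)} (hA : A.card = m) (hB : B.card = m) (hAB : sortedMinor x m A B ≠ 0)
    {i : Fin n} (hi : i ∉ A) :
    ∃ l, l ∉ B ∧ sortedMinor x (m + 1) (insert i A) (insert l B) ≠ 0 := by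
  by_contra! hcon
  obtain ⟨f, c, hf, hfc⟩ := exists_eq_sum_of_sortedMinor_insert_eq_zero x hA hB hAB
  set v : Fin n → ℝ := Pi.single i 1 - ∑ a, c i a • Pi.single (f a) 1 with hv
  have hvx : v ᵥ* x = 0 := by
    rw [hv, sub_vecMul, sum_vecMul]
    funext s
    simp [smul_vecMul, hfc i s fun _ => hcon s]
  have hvi : v i = 1 := by
    have : ∀ a, i ≠ f a := fun a e => hi (e ▸ hf a)
    simp [hv, this]
  have hdet : x.det = 0 := exists_vecMul_eq_zero_iff.1
    ⟨v, fun h => by simp [h] at hvi, hvx⟩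
  exact ((isUnit_iff_isUnit_det x).1 hx).ne_zero hdet

/-- In an invertible totally nonnegative matrix, a vanishing bordered minor at `(i, j)`, where
`i` is below and `j` is to the left of the block, forces all minors of the same order to the upper
right of `(i, j)` to vanish, provided row `i` has a nonzero bordered minor to the left of `j`. -/
theorem TotallyNonneg.det_submatrix_eq_zero_of_upper_right {x : Matrix (Fin n) (Fin n) ℝ}
    (hx : IsUnit x) (htnn : TotallyNonneg x) {m : ℕ} {A B : Finset (Fin n)} (hA : A.card = m)
    (hB : B.card = m) (hAB : sortedMinor x m A B ≠ 0) {i j l : Fin n} (hi : i ∉ A) (hj : j ∉ B)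
    (hl : l ∉ B) (hlj : l < j) (hij : sortedMinor x (m + 1) (insert i A) (insert j B) = 0)
    (hil : sortedMinor x (m + 1) (insert i A) (insert l B) ≠ 0)
    {f g : Fin (m + 1) → Fin n} (hf : ∀ a, f a ≤ i) (hg : ∀ a, j ≤ g a) :
    (x.submatrix f g).det = 0 := by
  have hnn := htnn.sortedMinor_nonneg (m + 1)
  have hcol : ∀ r, r ∉ A → r ≤ i → sortedMinor x (m + 1) (insert r A) (insert j B) = 0 := by
    intro r hr hri
    obtain rfl | hri := hri.eq_or_lt
    · exact hij
    have h := htnn.sortedMinor_insert_mul_le hA hB hr hi hl hj hri hlj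
    rw [hij, mul_zero] at h
    have := mul_nonneg (hnn (insert r A) (insert j B)) (hnn (insert i A) (insert l B))
    exact (mul_eq_zero.1 (le_antisymm h this)).resolve_right hil
  obtain ⟨k, hk, hkj⟩ := exists_sortedMinor_insert_ne_zero ((isUnit_transpose x).2 hx) hB hA
    (by rwa [sortedMinor_transpose]) hj
  rw [sortedMinor_transpose] at hkj
  have hik : i < k := lt_of_not_ge fun h => hkj (hcol k hk h)
  have hzero : ∀ r s, r ≤ i → j ≤ s → r ∉ A → s ∉ B →
      sortedMinor x (m + 1) (insert r A) (insert s B) = 0 := by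
    intro r s hri hjs hr hs
    obtain rfl | hjs := hjs.eq_or_lt
    · exact hcol r hr hri
    have h := htnn.sortedMinor_insert_mul_le hA hB hr hk hj hs (hri.trans_lt hik) hjs
    rw [hcol r hr hri, zero_mul] at h
    have := mul_nonneg (hnn (insert r A) (insert s B)) (hnn (insert k A) (insert j B))
    exact (mul_eq_zero.1 (le_antisymm h this)).resolve_right hkj
  obtain ⟨φ, c, -, hc⟩ := exists_eq_sum_of_sortedMinor_insert_eq_zero x hA hB hAB
  have hfac : x.submatrix f g = (Matrix.of fun a b => c (f a) b) * x.submatrix φ g := by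
    ext a b
    simpa [mul_apply] using hc (f a) (g b) (hzero _ _ (hf a) (hg b))
  by_contra hne
  have hrank := rank_of_isUnit _ ((isUnit_iff_isUnit_det _).2 (isUnit_iff_ne_zero.2 hne))
  rw [hfac, Fintype.card_fin] at hrank
  have h1 := rank_mul_le_left (Matrix.of fun a b => c (f a) b) (x.submatrix φ g)
  have h2 := rank_le_width (Matrix.of fun a b => c (f a) b)
  omega

/-- If an invertible totally nonnegative matrix has a vanishing minor, and its minors of the
preceding order are positive, then all minors of the same order taken either from the upper right
or from the lower left region spanned by the vanishing minor are zero. -/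
theorem TotallyNonneg.corner_eq_zero_of_minor_eq_zero {x : Matrix (Fin n) (Fin n) ℝ}
    (hx : IsUnit x) (htnn : TotallyNonneg x) {m : ℕ}
    (hlow : ∀ f g : Fin m → Fin n, StrictMono f → StrictMono g → 0 < (x.submatrix f g).det)
    {f g : Fin (m + 1) → Fin n} (hf : StrictMono f) (hg : StrictMono g)
    (hfg : (x.submatrix f g).det = 0) :
    (∀ φ γ : Fin (m + 1) → Fin n, (∀ a, φ a ≤ f (Fin.last m)) → (∀ a, g 0 ≤ γ a) →
      (x.submatrix φ γ).det = 0) ∨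
    (∀ φ γ : Fin (m + 1) → Fin n, (∀ a, f 0 ≤ φ a) → (∀ a, γ a ≤ g (Fin.last m)) →
      (x.submatrix φ γ).det = 0) := by
  set I := univ.image f with hI
  set J := univ.image g with hJ
  have hIc : I.card = m + 1 := card_image_univ_of_injective hf.injective
  have hJc : J.card = m + 1 := card_image_univ_of_injective hg.injective
  have hfI : ∀ u, f u ∈ I := fun u => mem_image_of_mem f (mem_univ u)
  have hgJ : ∀ u, g u ∈ J := fun u => mem_image_of_mem g (mem_univ u)
  have hIJ : sortedMinor x (m + 1) I J = 0 := by rw [hI, hJ, sortedMinor_image x hf hg, hfg]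
  have hpos : ∀ u v, 0 < sortedMinor x m (I.erase (f u)) (J.erase (g v)) := fun u v => by
    rw [hI, hJ, ← det_submatrix_comp_succAbove x hf hg]
    exact hlow _ _ (hf.comp (Fin.strictMono_succAbove u)) (hg.comp (Fin.strictMono_succAbove v))
  have hIe : ∀ u, (I.erase (f u)).card = m := fun u => by
    rw [card_erase_of_mem (hfI u), hIc, Nat.add_sub_cancel]
  have hJe : ∀ u, (J.erase (g u)).card = m := fun u => by
    rw [card_erase_of_mem (hgJ u), hJc, Nat.add_sub_cancel]
  obtain ⟨l, hl, hne⟩ := exists_sortedMinor_insert_ne_zero hx (hIe (Fin.last m)) (hJe 0)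
    (hpos _ _).ne' (notMem_erase _ _)
  have hl0 : l ≠ g 0 := by
    rintro rfl
    rw [insert_erase (hfI _), insert_erase (hgJ _)] at hne
    exact hne hIJ
  obtain hlt | hgt := hl0.lt_or_gt
  · left
    intro φ γ hφ hγ
    exact htnn.det_submatrix_eq_zero_of_upper_right hx (hIe (Fin.last m)) (hJe 0)
      (hpos _ _).ne' (notMem_erase _ _) (notMem_erase _ _) hl hlt
      (by rwa [insert_erase (hfI _), insert_erase (hgJ _)]) hne hφ hγ
  · right
    intro φ γ hφ hγ
    have hlJ : l ∉ J := fun h => hl (mem_erase.2 ⟨hl0, h⟩)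
    rw [insert_erase (hfI _)] at hne
    obtain ⟨hcl, hne'⟩ := htnn.exchange_column hIc hJc (hfI 0) (hgJ 0)
      (by simpa [hJ] using fun u => hg.monotone (Fin.zero_le u)) (hgJ (Fin.last m))
      (by simpa [hJ] using fun u => hg.monotone (Fin.le_last u)) hlJ
      (by simpa [hJ] using hpos 0) hIJ hne hgt
    have hlB : l ∉ J.erase (g (Fin.last m)) := fun h => hlJ (mem_of_mem_erase h)
    obtain ⟨k, hk, hkne⟩ := exists_sortedMinor_insert_ne_zero ((isUnit_transpose x).2 hx)
      (hJe (Fin.last m)) (hIe 0) (by rw [sortedMinor_transpose]; exact (hpos _ _).ne')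
      (notMem_erase (g (Fin.last m)) J)
    have hk0 : k ≠ f 0 := by
      rintro rfl
      rw [insert_erase (hfI _), insert_erase (hgJ _), sortedMinor_transpose] at hkne
      exact hkne hIJ
    have hkf : k < f 0 := by
      refine lt_of_le_of_ne (le_of_not_gt fun h => hkne ?_) hk0
      have := htnn.sortedMinor_insert_mul_le (hIe 0) (hJe (Fin.last m)) (notMem_erase _ _) hk
        (notMem_erase _ _) hlB h hcl
      rw [insert_erase (hfI _), insert_erase (hgJ _), hIJ, zero_mul] at this
      rw [sortedMinor_transpose]
      have h2 := mul_nonneg (htnn.sortedMinor_nonneg (m + 1) I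
        (insert l (J.erase (g (Fin.last m))))) (htnn.sortedMinor_nonneg (m + 1)
          (insert k (I.erase (f 0))) (insert (g (Fin.last m)) (J.erase (g (Fin.last m)))))
      rw [insert_erase (hgJ _)] at h2 ⊢
      exact (mul_eq_zero.1 (le_antisymm this h2)).resolve_left hne'
    rw [← det_transpose]
    exact htnn.transpose.det_submatrix_eq_zero_of_upper_right ((isUnit_transpose x).2 hx)
      (hJe (Fin.last m)) (hIe 0) (by rw [sortedMinor_transpose]; exact (hpos _ _).ne')
      (notMem_erase _ _) (notMem_erase _ _) hk hkf
      (by rwa [sortedMinor_transpose, insert_erase (hfI _), insert_erase (hgJ _)]) hkne hγ hφ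

end SortedMinors

/-- Gasca–Peña criterion: an invertible totally nonnegative matrix is totally positive
iff all solid antidiagonal corner minors (rows 1..k with columns n-k+1..n, and
rows n-k+1..n with columns 1..k) are positive. -/
theorem stmt2 (n : ℕ) (hn : 1 ≤ n) (x : Matrix (Fin n) (Fin n) ℝ)
    (hx : IsUnit x) (htnn : TotallyNonneg x) :
    TotallyPos x ↔
      ∀ (k : ℕ), 1 ≤ k → ∀ (hk : k ≤ n),
        0 < (x.submatrix
              (fun a : Fin k => (⟨a.val, by have := a.isLt; omega⟩ : Fin n))
              (fun a : Fin k => (⟨n - k + a.val, by have := a.isLt; omega⟩ : Fin n))).det ∧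
        0 < (x.submatrix
              (fun a : Fin k => (⟨n - k + a.val, by have := a.isLt; omega⟩ : Fin n))
              (fun a : Fin k => (⟨a.val, by have := a.isLt; omega⟩ : Fin n))).det := by
  refine ⟨fun h k _ hk => ⟨h k _ _ (fun a b hab => ?_) (fun a b hab => ?_),
    h k _ _ (fun a b hab => ?_) (fun a b hab => ?_)⟩, fun hcorner k => ?_⟩
  iterate 4
    · have : a.val < b.val := hab
      simp only [Fin.lt_def]
      omega
  induction k with
  | zero =>
    intro f g _ _
    rw [Matrix.det_fin_zero]
    exact one_pos
  | succ m ih =>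
    intro f g hf hg
    have hmn : m + 1 ≤ n := by simpa using Fintype.card_le_of_injective f hf.injective
    have hlow : ∀ {h : Fin (m + 1) → Fin n}, StrictMono h → ∀ a, (h 0).val + a.val ≤ (h a).val := by
      intro h hh a
      induction a using Fin.induction with
      | zero => simp
      | succ a iha =>
        have : (h a.castSucc).val < (h a.succ).val := hh (Fin.castSucc_lt_succ (i := a))
        simp only [Fin.val_castSucc, Fin.val_succ] at iha ⊢
        omega
    refine lt_of_le_of_ne (htnn _ f g hf hg) fun h0 => ?_
    obtain ⟨h1, h2⟩ := hcorner (m + 1) (Nat.le_add_left 1 m) hmn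
    have hfl := hlow hf (Fin.last m)
    have hgl := hlow hg (Fin.last m)
    have hfn := (f (Fin.last m)).isLt
    have hgn := (g (Fin.last m)).isLt
    rw [Fin.val_last] at hfl hgl
    obtain h | h := htnn.corner_eq_zero_of_minor_eq_zero hx ih hf hg h0.symm
    · refine h1.ne' (h _ _ (fun a => ?_) (fun a => ?_)) <;>
        · have := a.isLt
          simp only [Fin.le_def]
          omega
    · refine h2.ne' (h _ _ (fun a => ?_) (fun a => ?_)) <;>
        · have := a.isLt
          simp only [Fin.le_def]
          omega
end

section
/- Let n ≥ 2 and let i, j ∈ {1, …, n−1}. For an n×n real matrix x define the i-indicator minor Δ_{j→i}(x) as follows: if j ≥ i, Δ_{j→i}(x) is the determinant of the submatrix of x with row set {1, …, j+1} \ {i+1} and column set {1, …, j+1} \ {i}; if j < i, Δ_{j→i}(x) is the determinant of the submatrix with row set {1, …, j−1} ∪ {i} and column set {1, …, j−1} ∪ {i+1}. Then for every invertible totally nonnegative n×n real matrix x: (1) Δ_{j→i}(x) > 0 if and only if there exist indices k ≤ i < l with x_{k,l} ≠ 0, and Δ_{j→i}(x) = 0 otherwise; (2) Δ_{j→i}(xᵀ)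 > 0 if and only if there exist indices k ≤ i < l with x_{l,k} ≠ 0, and Δ_{j→i}(xᵀ) = 0 otherwise. -/
open Matrix

/-- The `i`-indicator minor `Δ_{j→i}(x)` (with `i, j` 1-indexed, `1 ≤ i, j ≤ n-1`).
If `j ≥ i`, it is the minor with (1-indexed) row set `{1,…,j+1} \ {i+1}` and column set
`{1,…,j+1} \ {i}`; if `j < i`, it is the minor with row set `{1,…,j−1} ∪ {i}` and column
set `{1,…,j−1} ∪ {i+1}`. (Indices are converted to 0-indexed form; the `% n` is
a harmless clamp making the definition total, and it is the identity whenever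
`1 ≤ i, j ≤ n-1`.) -/
noncomputable def Delta {n : ℕ} (hn : 0 < n) (i j : ℕ)
    (x : Matrix (Fin n) (Fin n) ℝ) : ℝ :=
  if i ≤ j then
    (Matrix.of fun k l : Fin j =>
      x ⟨(if (k : ℕ) < i then (k : ℕ) else (k : ℕ) + 1) % n, Nat.mod_lt _ hn⟩
        ⟨(if (l : ℕ) < i - 1 then (l : ℕ) else (l : ℕ) + 1) % n, Nat.mod_lt _ hn⟩).det
  else
    (Matrix.of fun k l : Fin j =>
      x ⟨(if (k : ℕ) < j - 1 then (k : ℕ) else i - 1) % n, Nat.mod_lt _ hn⟩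
        ⟨(if (l : ℕ) < j - 1 then (l : ℕ) else i) % n, Nat.mod_lt _ hn⟩).det

/-- Invertible totally nonnegative matrices. -/
structure InvTNN {n : ℕ} (x : Matrix (Fin n) (Fin n) ℝ) : Prop where
  tnn : TotallyNonneg x
  det_ne_zero : x.det ≠ 0

/-- The Schur complement of the top-left entry. -/
noncomputable def schurHead {n : ℕ} (x : Matrix (Fin (n + 1)) (Fin (n + 1)) ℝ) :
    Matrix (Fin n) (Fin n) ℝ :=
  Matrix.of fun k l => x k.succ l.succ - x k.succ 0 * x 0 l.succ / x 0 0

theorem det_eq_mul_det_schurHead {n : ℕ} (x : Matrix (Fin (n + 1)) (Fin (n + 1)) ℝ)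
    (h : x 0 0 ≠ 0) : x.det = x 0 0 * (schurHead x).det := by
  let c : Fin (n + 1) → ℝ := Fin.cons 0 fun k => x k.succ 0 / x 0 0
  have key := Matrix.det_eq_of_forall_row_eq_smul_add_const (A := x)
    (B := Matrix.of fun k l => x k l - c k * x 0 l) c 0 (by simp [c]) (by
      intro k l
      simp [c])
  rw [key, Matrix.det_succ_column_zero, Fin.sum_univ_succ, Finset.sum_eq_zero]
  · simp only [c, Matrix.of_apply, Fin.cons_zero, Fin.val_zero, pow_zero, one_mul, zero_mul,
      sub_zero, add_zero]
    congr 2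
    ext k l
    simp [schurHead]
    ring
  · intro k _
    simp [c, h]

theorem det_submatrix_cons_zero {n k : ℕ} (x : Matrix (Fin (n + 1)) (Fin (n + 1)) ℝ)
    (h : x 0 0 ≠ 0) (f g : Fin k → Fin n) :
    (x.submatrix (Fin.cons 0 fun a => (f a).succ : Fin (k + 1) → Fin (n + 1))
      (Fin.cons 0 fun a => (g a).succ : Fin (k + 1) → Fin (n + 1))).det =
      x 0 0 * ((schurHead x).submatrix f g).det := by
  rw [det_eq_mul_det_schurHead _ (by simpa using h)]
  congr 1

theorem Fin.succAbove_succ_eq_cons {n : ℕ} (d : Fin (n + 1)) :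
    d.succ.succAbove = Fin.cons 0 fun a => (d.succAbove a).succ := by
  funext a
  refine Fin.cases ?_ (fun a => ?_) a <;> simp

theorem Fin.strictMono_cons_zero_succ_comp {n k : ℕ} {f : Fin k → Fin n} (hf : StrictMono f) :
    StrictMono (Fin.cons 0 fun a => (f a).succ : Fin (k + 1) → Fin (n + 1)) := by
  intro a b
  refine Fin.cases ?_ (fun a => ?_) a <;> refine Fin.cases ?_ (fun b => ?_) b
  · simp
  · simp
  · simp
  · intro h
    simpa using hf (Fin.succ_lt_succ_iff.mp h)

namespace TotallyNonneg

variable {n : ℕ} {x : Matrix (Fin n) (Fin n) ℝ}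

theorem apply_nonneg (h : TotallyNonneg x) (k l : Fin n) : 0 ≤ x k l := by
  have := h 1 ![k] ![l] (Subsingleton.strictMono _) (Subsingleton.strictMono _)
  rwa [Matrix.det_fin_one] at this

theorem two_by_two (h : TotallyNonneg x) {a b c d : Fin n} (hab : a < b) (hcd : c < d) :
    x a d * x b c ≤ x a c * x b d := by
  have := h 2 ![a, b] ![c, d] (by simpa [Fin.strictMono_iff_lt_succ] using hab)
    (by simpa [Fin.strictMono_iff_lt_succ] using hcd)
  rw [Matrix.det_fin_two] at this
  simpa using this

theorem submatrix {m : ℕ} (h : TotallyNonneg x) {f g : Fin m → Fin n} (hf : StrictMono f)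
    (hg : StrictMono g) : TotallyNonneg (x.submatrix f g) :=
  fun k p q hp hq => by
    simpa [Matrix.submatrix_submatrix] using h k _ _ (hf.comp hp) (hg.comp hq)

theorem transpose_s8 (h : TotallyNonneg x) : TotallyNonneg xᵀ := fun k f g hf hg => by
  rw [← Matrix.transpose_submatrix, Matrix.det_transpose]
  exact h k g f hg hf

theorem rev (h : TotallyNonneg x) : TotallyNonneg (x.submatrix Fin.rev Fin.rev) :=
  fun k f g hf hg => by
    have hmono : ∀ {p : Fin k → Fin n}, StrictMono p →
        StrictMono fun a => Fin.rev (p (Fin.rev a)) :=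
      fun hp a b hab => Fin.rev_lt_rev.mpr (hp (Fin.rev_lt_rev.mpr hab))
    have := h k _ _ (hmono hf) (hmono hg)
    rw [← Matrix.det_submatrix_equiv_self Fin.revPerm] at this
    convert this using 2
    ext a b
    simp

end TotallyNonneg

namespace InvTNN

variable {n : ℕ}

theorem transpose_s8 {x : Matrix (Fin n) (Fin n) ℝ} (h : InvTNN x) : InvTNN xᵀ :=
  ⟨h.tnn.transpose_s8, by simpa using h.det_ne_zero⟩

theorem rev {x : Matrix (Fin n) (Fin n) ℝ} (h : InvTNN x) :
    InvTNN (x.submatrix Fin.rev Fin.rev) :=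
  ⟨h.tnn.rev, by
    have := Matrix.det_submatrix_equiv_self Fin.revPerm x
    exact fun h0 => h.det_ne_zero (this.symm.trans h0)⟩

theorem zero_zero_pos {x : Matrix (Fin (n + 1)) (Fin (n + 1)) ℝ} (h : InvTNN x) :
    0 < x 0 0 := by
  refine lt_of_le_of_ne (h.tnn.apply_nonneg _ _) fun h0 => ?_
  by_cases hrow : ∀ l, x 0 l = 0
  · exact h.det_ne_zero (Matrix.det_eq_zero_of_row_eq_zero 0 hrow)
  · push Not at hrow
    obtain ⟨l, hl⟩ := hrow
    have hl0 : 0 < l := Fin.pos_of_ne_zero (by rintro rfl; exact hl h0.symm)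
    refine h.det_ne_zero (Matrix.det_eq_zero_of_column_eq_zero 0 fun k => ?_)
    rcases eq_or_ne k 0 with rfl | hk
    · exact h0.symm
    have h2 := h.tnn.two_by_two (Fin.pos_of_ne_zero hk) hl0
    rw [← h0, zero_mul] at h2
    have hl' := lt_of_le_of_ne (h.tnn.apply_nonneg 0 l) hl.symm
    exact le_antisymm (nonpos_of_mul_nonpos_right h2 hl') (h.tnn.apply_nonneg _ _)

theorem schurHead {x : Matrix (Fin (n + 1)) (Fin (n + 1)) ℝ} (h : InvTNN x) :
    InvTNN (schurHead x) := by
  have h0 := h.zero_zero_pos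
  refine ⟨fun k f g hf hg => ?_, fun hd => h.det_ne_zero ?_⟩
  · have := h.tnn _ _ _ (Fin.strictMono_cons_zero_succ_comp hf) (Fin.strictMono_cons_zero_succ_comp hg)
    rw [det_submatrix_cons_zero x h0.ne'] at this
    exact nonneg_of_mul_nonneg_right this h0
  · rw [det_eq_mul_det_schurHead x h0.ne', hd, mul_zero]

theorem submatrix_succAbove {x : Matrix (Fin (n + 1)) (Fin (n + 1)) ℝ} (h : InvTNN x)
    (c : Fin (n + 1)) : InvTNN (x.submatrix c.succAbove c.succAbove) := by
  refine ⟨h.tnn.submatrix (Fin.strictMono_succAbove c) (Fin.strictMono_succAbove c), ?_⟩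
  induction n with
  | zero => simp
  | succ n ih =>
    have hsucc : ∀ {z : Matrix (Fin (n + 2)) (Fin (n + 2)) ℝ}, InvTNN z →
        ∀ d : Fin (n + 1), (z.submatrix d.succ.succAbove d.succ.succAbove).det ≠ 0 := by
      intro z hz d
      rw [Fin.succAbove_succ_eq_cons, det_submatrix_cons_zero z hz.zero_zero_pos.ne']
      exact mul_ne_zero hz.zero_zero_pos.ne' (ih hz.schurHead d)
    refine Fin.cases ?_ (fun d => hsucc h d) c
    have := hsucc h.rev (Fin.last n)
    rw [← Matrix.det_submatrix_equiv_self Fin.revPerm] at this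
    convert this using 2
    ext a b
    simp [Fin.rev_castSucc]

theorem submatrix {x : Matrix (Fin n) (Fin n) ℝ} (h : InvTNN x) {m : ℕ} {f : Fin m → Fin n}
    (hf : StrictMono f) : InvTNN (x.submatrix f f) := by
  induction n with
  | zero =>
    obtain rfl : m = 0 := by simpa using Fintype.card_le_of_injective f hf.injective
    exact ⟨h.tnn.submatrix hf hf, by simp⟩
  | succ n ih =>
    by_cases hs : Function.Surjective f
    · obtain rfl : m = n + 1 := by
        simpa using Fintype.card_of_bijective ⟨hf.injective, hs⟩
      refine ⟨h.tnn.submatrix hf hf, fun h0 => h.det_ne_zero ?_⟩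
      rw [← Matrix.det_submatrix_equiv_self (Equiv.ofBijective f ⟨hf.injective, hs⟩) x]
      exact h0
    · obtain ⟨c, hc⟩ := not_forall.mp hs
      have hex : ∀ a, ∃ b, c.succAbove b = f a := fun a =>
        Fin.exists_succAbove_eq fun e => hc ⟨a, e⟩
      choose g hg using hex
      have hgm : StrictMono g := fun a b hab => by
        rw [← (Fin.strictMono_succAbove c).lt_iff_lt, hg, hg]
        exact hf hab
      have := ih (h.submatrix_succAbove c) hgm
      rwa [Matrix.submatrix_submatrix, show c.succAbove ∘ g = f from funext hg] at this

theorem diag_pos {x : Matrix (Fin n) (Fin n) ℝ} (h : InvTNN x) (a : Fin n) : 0 < x a a := by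
  simpa using (h.submatrix (f := ![a]) (Subsingleton.strictMono _)).zero_zero_pos

/-- A nonzero entry weakly northeast of a superdiagonal position forces the entry there to be
nonzero. -/
theorem superdiag_ne_zero {x : Matrix (Fin n) (Fin n) ℝ} (h : InvTNN x) {a b k l : Fin n}
    (hab : a < b) (hka : k ≤ a) (hbl : b ≤ l) (hkl : x k l ≠ 0) : x a b ≠ 0 := by
  have hal : x a l ≠ 0 := by
    rcases hka.eq_or_lt with rfl | hka
    · exact hkl
    intro h0
    have h2 := h.tnn.two_by_two hka (hab.trans_le hbl)
    rw [h0, mul_zero] at h2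
    have := mul_pos (lt_of_le_of_ne (h.tnn.apply_nonneg k l) hkl.symm) (h.diag_pos a)
    linarith
  rcases hbl.eq_or_lt with rfl | hbl
  · exact hal
  intro h0
  have h2 := h.tnn.two_by_two hab hbl
  rw [h0, zero_mul] at h2
  have := mul_pos (lt_of_le_of_ne (h.tnn.apply_nonneg a l) hal.symm) (h.diag_pos b)
  linarith

theorem schurHead_apply_ne_zero_iff {x : Matrix (Fin (n + 1)) (Fin (n + 1)) ℝ} (h : InvTNN x)
    {a b : Fin n} (hab : a < b) : _root_.schurHead x a b ≠ 0 ↔ x a.succ b.succ ≠ 0 := by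
  have h0 := h.zero_zero_pos
  have hp := h.tnn.apply_nonneg 0 b.succ
  have hq := h.tnn.apply_nonneg a.succ 0
  have hnn := h.schurHead.tnn.apply_nonneg a b
  have haa := h.schurHead.diag_pos a
  have h2 := h.tnn.two_by_two (Fin.succ_pos a) (Fin.succ_lt_succ_iff.mpr hab)
  simp only [_root_.schurHead, Matrix.of_apply] at *
  rw [not_iff_not]
  constructor
  · intro hz
    by_contra hx
    have hpos := lt_of_le_of_ne (h.tnn.apply_nonneg a.succ b.succ) (Ne.symm hx)
    have hpq : x 0 0 * x a.succ b.succ = x a.succ 0 * x 0 b.succ := by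
      field_simp at hz
      linarith
    have hdiag : x a.succ 0 * x 0 a.succ < x 0 0 * x a.succ a.succ := by
      have := mul_pos h0 haa
      field_simp at this
      linarith
    have hp' : 0 < x 0 b.succ := by
      refine lt_of_le_of_ne hp fun e => ?_
      rw [← e, mul_zero] at hpq
      exact (mul_pos h0 hpos).ne' hpq
    have h3 := mul_lt_mul_of_pos_right hdiag hp'
    have h4 := mul_le_mul_of_nonneg_left h2 h0.le
    have h5 : x 0 a.succ * (x 0 0 * x a.succ b.succ) =
        x 0 a.succ * (x a.succ 0 * x 0 b.succ) := by rw [hpq]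
    linarith
  · intro hx
    rw [hx] at hnn ⊢
    have := div_nonneg (mul_nonneg hq hp) h0.le
    linarith

/-- The almost principal minor omitting row `a + 1` and column `a` vanishes exactly when the
entry in position `(a, a + 1)` does. -/
theorem det_submatrix_succAbove_ne_zero_iff {m : ℕ}
    {x : Matrix (Fin (m + 2)) (Fin (m + 2)) ℝ} (h : InvTNN x) (a : Fin (m + 1)) :
    (x.submatrix a.succ.succAbove a.castSucc.succAbove).det ≠ 0 ↔ x a.castSucc a.succ ≠ 0 := by
  induction m with
  | zero =>
    obtain rfl : a = 0 := Fin.fin_one_eq_zero a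
    simp
  | succ m ih =>
    have hsucc : ∀ {z : Matrix (Fin (m + 3)) (Fin (m + 3)) ℝ}, InvTNN z →
        ∀ b : Fin (m + 1), (z.submatrix b.succ.succ.succAbove b.succ.castSucc.succAbove).det ≠ 0 ↔
          z b.succ.castSucc b.succ.succ ≠ 0 := by
      intro z hz b
      rw [Fin.castSucc_succ, Fin.succAbove_succ_eq_cons b.succ,
        Fin.succAbove_succ_eq_cons b.castSucc,
        det_submatrix_cons_zero z hz.zero_zero_pos.ne', mul_ne_zero_iff_left hz.zero_zero_pos.ne',
        ih hz.schurHead b, hz.schurHead_apply_ne_zero_iff Fin.castSucc_lt_succ]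
    refine Fin.cases ?_ (fun b => hsucc h b) a
    have := hsucc h.rev.transpose_s8 (Fin.last m)
    rw [← Matrix.det_submatrix_equiv_self Fin.revPerm, ← Matrix.det_transpose] at this
    convert this using 2
    · congr 1
      ext a b
      simp [Fin.rev_succAbove, Fin.rev_castSucc]
    · simp [Fin.rev_castSucc]

end InvTNN

theorem InvTNN.delta_nonneg_and_ne_zero_iff {n : ℕ} (hn : 0 < n) {i j : ℕ} (hi1 : 1 ≤ i)
    (hi2 : i ≤ n - 1) (hj1 : 1 ≤ j) (hj2 : j ≤ n - 1) {x : Matrix (Fin n) (Fin n) ℝ}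
    (h : InvTNN x) :
    0 ≤ Delta hn i j x ∧
      (Delta hn i j x ≠ 0 ↔ ∃ k l : Fin n, (k : ℕ) < i ∧ i ≤ (l : ℕ) ∧ x k l ≠ 0) := by
  obtain ⟨m, rfl⟩ : ∃ m, j = m + 1 := ⟨j - 1, by omega⟩
  let f : Fin (m + 2) → Fin n := fun k =>
    ⟨if (k : ℕ) < m ∨ i ≤ m + 1 then k else k + (i - (m + 1)), by split_ifs <;> omega⟩
  have hf : StrictMono f := by
    intro a b hab
    simp only [f, Fin.lt_def] at hab ⊢
    split_ifs <;> omega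
  let a : Fin (m + 1) := ⟨min (i - 1) m, by omega⟩
  have hD : Delta hn i (m + 1) x =
      ((x.submatrix f f).submatrix a.succ.succAbove a.castSucc.succAbove).det := by
    unfold Delta
    split_ifs with hij
    all_goals
      congr 1
      ext k l
      have hk := k.isLt
      have hl := l.isLt
      simp only [Matrix.of_apply, Matrix.submatrix_apply]
      congr 1 <;> ext <;>
        simp only [f, a, Fin.succAbove, Fin.lt_def, Fin.val_castSucc, Fin.succ_mk,
          Fin.castSucc_mk] <;>
        rw [Nat.mod_eq_of_lt (by split_ifs <;> omega)] <;>
        split_ifs <;> simp only [Fin.val_castSucc, Fin.val_succ] at * <;> omega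
  have hfa : ((f a.castSucc : Fin n) : ℕ) = i - 1 := by
    simp only [f, a, Fin.val_castSucc]
    split_ifs <;> omega
  have hfb : ((f a.succ : Fin n) : ℕ) = i := by
    simp only [f, a, Fin.val_succ]
    split_ifs <;> omega
  have hw := h.submatrix hf
  rw [hD, hw.det_submatrix_succAbove_ne_zero_iff a]
  refine ⟨hw.tnn _ _ _ (Fin.strictMono_succAbove _) (Fin.strictMono_succAbove _),
    fun hne => ⟨_, _, by omega, hfb.ge, hne⟩, ?_⟩
  rintro ⟨k, l, hk, hl, hkl⟩
  exact h.superdiag_ne_zero (hf Fin.castSucc_lt_succ) (Fin.le_def.mpr (by omega))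
    (Fin.le_def.mpr (by omega)) hkl

/-- For an invertible totally nonnegative matrix `x` and 1-indexed `i, j ∈ {1,…,n-1}`:
the indicator minor `Δ_{j→i}(x)` is positive iff `x` has a nonzero entry `x_{k,l}` with
(1-indexed) `k ≤ i < l`, and vanishes otherwise; and `Δ_{j→i}(xᵀ)` is positive iff
`x` has a nonzero entry `x_{l,k}` with `k ≤ i < l`, and vanishes otherwise.
(In the 0-indexed condition below, a 1-indexed pair `k ≤ i < l` corresponds to
`(k : ℕ) < i ∧ i ≤ (l : ℕ)`.) -/
theorem stmt8 (n : ℕ) (hn : 2 ≤ n) (i j : ℕ) (hi1 : 1 ≤ i) (hi2 : i ≤ n - 1)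
    (hj1 : 1 ≤ j) (hj2 : j ≤ n - 1) (x : Matrix (Fin n) (Fin n) ℝ)
    (hx : IsUnit x) (htnn : TotallyNonneg x) :
    ((0 < Delta (by omega) i j x ↔
        ∃ k l : Fin n, (k : ℕ) < i ∧ i ≤ (l : ℕ) ∧ x k l ≠ 0) ∧
      (¬ (∃ k l : Fin n, (k : ℕ) < i ∧ i ≤ (l : ℕ) ∧ x k l ≠ 0) →
        Delta (by omega) i j x = 0)) ∧
    ((0 < Delta (by omega) i j xᵀ ↔
        ∃ k l : Fin n, (k : ℕ) < i ∧ i ≤ (l : ℕ) ∧ x l k ≠ 0) ∧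
      (¬ (∃ k l : Fin n, (k : ℕ) < i ∧ i ≤ (l : ℕ) ∧ x l k ≠ 0) →
        Delta (by omega) i j xᵀ = 0)) := by
  have h : InvTNN x := ⟨htnn, ((Matrix.isUnit_iff_isUnit_det x).mp hx).ne_zero⟩
  obtain ⟨hnn, hiff⟩ := h.delta_nonneg_and_ne_zero_iff (by omega) hi1 hi2 hj1 hj2
  obtain ⟨hnnT, hiffT⟩ := h.transpose_s8.delta_nonneg_and_ne_zero_iff (by omega) hi1 hi2 hj1 hj2
  have hswap : (∃ k l : Fin n, (k : ℕ) < i ∧ i ≤ (l : ℕ) ∧ xᵀ k l ≠ 0) ↔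
      ∃ k l : Fin n, (k : ℕ) < i ∧ i ≤ (l : ℕ) ∧ x l k ≠ 0 := Iff.rfl
  rw [hswap] at hiffT
  exact ⟨⟨hnn.lt_iff_ne.trans (ne_comm.trans hiff), fun hne => not_not.mp (mt hiff.mp hne)⟩,
    hnnT.lt_iff_ne.trans (ne_comm.trans hiffT), fun hne => not_not.mp (mt hiffT.mp hne)⟩
end
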